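/- arXiv:2202.02766 — 2 statements merged into one kernel-verified Lean document; each statement's English description precedes it below -/
import Mathlib

section
/- Let ξ_{k,r}: Fin(ℝ^d) → [0,∞) satisfy translation/scale invariance (ξ_{k,r}(αS+x) = ξ_{k,r/α}(S)), localization (ξ_{k,1}(S)=0 if diam(S) > r_max), and boundedness (‖ξ_{k,1}‖_∞ < ∞). Let q be a bounded, a.e.-continuous probability density on ℝ^d and X₁,...,X_k iid with density q. Then lim_{r→0} r^{−d(k−1)} E[ξ_{k,r}(X₁,...,X_k)] = ∫_{ℝ^d} q(x)^k dx · ∫_{(ℝ^d)^{k−1}} ξ_{k,1}(0, y₁,...,y_{k−1}) dy₁...dy_{k−1}. -/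
open MeasureTheory Real Filter

theorem lintegral_fin_prod_eq_prod {α : Type*} [MeasurableSpace α] (μ : Measure α) [SigmaFinite μ]
    {n : ℕ} (f : Fin n → α → ENNReal) (hf : ∀ i, Measurable (f i)) :
    ∫⁻ x, ∏ i, f i (x i) ∂(Measure.pi fun _ => μ) = ∏ i, ∫⁻ x, f i x ∂μ := by
  induction n with
  | zero => simp
  | succ n ih =>
    have h := (measurePreserving_piFinSuccAbove (fun _ : Fin (n + 1) => μ) 0).symm
    rw [← h.lintegral_comp_emb (MeasurableEquiv.measurableEmbedding _)]
    simp only [MeasurableEquiv.piFinSuccAbove_symm_apply, Fin.insertNthEquiv_zero,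
      Fin.consEquiv_apply, Fin.prod_univ_succ, Fin.cons_zero, Fin.cons_succ]
    rw [lintegral_prod_mul (f := f 0) (g := fun y : Fin n → α => ∏ i, f i.succ (y i))
      (hf 0).aemeasurable (Finset.measurable_fun_prod _ fun i _ =>
        (hf i.succ).comp (measurable_pi_apply i)).aemeasurable, ih _ fun i => hf i.succ]

theorem pi_withDensity_fin {α : Type*} [MeasurableSpace α] (μ : Measure α) [SigmaFinite μ]
    (n : ℕ) {f : α → ENNReal} (hf : Measurable f) [SigmaFinite (μ.withDensity f)] :
    Measure.pi (fun _ : Fin n => μ.withDensity f) =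
      (Measure.pi fun _ => μ).withDensity fun x => ∏ i, f (x i) := by
  refine Measure.pi_eq fun s hs => ?_
  rw [withDensity_apply _ (MeasurableSet.univ_pi hs),
    ← lintegral_indicator (MeasurableSet.univ_pi hs)]
  simp_rw [withDensity_apply _ (hs _), ← lintegral_indicator (hs _)]
  rw [← lintegral_fin_prod_eq_prod μ _ fun i => hf.indicator (hs i)]
  congr 1 with x
  by_cases h : x ∈ Set.univ.pi s
  · simp only [Set.indicator_of_mem h]
    exact Finset.prod_congr rfl fun i _ => (Set.indicator_of_mem (h i trivial) _).symm
  · rw [Set.indicator_of_notMem h]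
    simp only [Set.mem_univ_pi, not_forall] at h
    obtain ⟨i, hi⟩ := h
    exact (Finset.prod_eq_zero (Finset.mem_univ i) (Set.indicator_of_notMem hi _)).symm

theorem integral_pi_withDensity_cons_add_smul {E : Type*} [NormedAddCommGroup E] [NormedSpace ℝ E]
    [FiniteDimensional ℝ E] [MeasurableSpace E] [BorelSpace E] (μ : Measure E) [μ.IsAddHaarMeasure]
    {k : ℕ} {q : E → ℝ} (hq : Measurable q) (hq0 : ∀ x, 0 ≤ q x)
    [SigmaFinite (μ.withDensity fun x => ENNReal.ofReal (q x))]
    (f : (Fin (k + 1) → E) → ℝ) {r : ℝ} (hr : 0 < r) :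
    (∫ x, f x ∂(Measure.pi fun _ => μ.withDensity fun x => ENNReal.ofReal (q x)))
        / r ^ (Module.finrank ℝ E * k) =
      ∫ p, q p.1 * (∏ i, q (p.1 + r • p.2 i)) * f (Fin.cons p.1 fun i => p.1 + r • p.2 i)
        ∂(μ.prod (Measure.pi fun _ : Fin k => μ)) := by
  have hqm : Measurable fun x => ENNReal.ofReal (q x) := hq.ennreal_ofReal
  rw [pi_withDensity_fin μ (k + 1) hqm, integral_withDensity_eq_integral_toReal_smul
    (by fun_prop) (.of_forall fun x => ENNReal.prod_lt_top fun i _ => ENNReal.ofReal_lt_top)]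
  have h := (measurePreserving_piFinSuccAbove (fun _ : Fin (k + 1) => μ) 0).symm
  rw [← h.integral_comp (MeasurableEquiv.measurableEmbedding _)]
  have h0 : ∀ x, (ENNReal.ofReal (q x)).toReal = q x := fun x => ENNReal.toReal_ofReal (hq0 x)
  simp only [MeasurableEquiv.piFinSuccAbove_symm_apply, Fin.insertNthEquiv_zero, Fin.consEquiv_apply,
    Fin.prod_univ_succ, Fin.cons_zero, Fin.cons_succ, ENNReal.toReal_mul, ENNReal.toReal_prod, h0,
    smul_eq_mul]
  let e : E × (Fin k → E) ≃ₜ E × (Fin k → E) :=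
    { toFun := fun p => (p.1, fun i => p.1 + r • p.2 i)
      invFun := fun p => (p.1, fun i => r⁻¹ • (p.2 i - p.1))
      left_inv := fun p => by simp [smul_smul, hr.ne']
      right_inv := fun p => by simp [smul_smul, hr.ne']
      continuous_toFun := by fun_prop
      continuous_invFun := by fun_prop }
  have he : MeasurePreserving e (μ.prod (Measure.pi fun _ => μ))
      (μ.prod (ENNReal.ofReal (r ^ (Module.finrank ℝ E * k))⁻¹ • Measure.pi fun _ => μ)) := by
    refine (MeasurePreserving.id μ).skew_product (g := fun (x : E) (y : Fin k → E) i => x + r • y i)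
      (by unfold Function.uncurry; fun_prop) (.of_forall fun x => ?_)
    have h1 := Measure.map_addHaar_smul (Measure.pi fun _ : Fin k => μ) hr.ne'
    rw [Module.finrank_pi_fintype, Finset.sum_const, Finset.card_fin, smul_eq_mul, mul_comm,
      abs_of_pos (by positivity)] at h1
    have h2 : (fun (y : Fin k → E) i => x + r • y i) =
      (fun y => (fun _ => x) + y) ∘ (r • ·) := rfl
    rw [h2, ← Measure.map_map (by fun_prop) (by fun_prop), h1, Measure.map_smul,
      map_add_left_eq_self]
  have h3 := he.integral_comp e.measurableEmbedding
    fun p => q p.1 * (∏ i, q (p.2 i)) * f (Fin.cons p.1 p.2)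
  rw [Measure.prod_smul_right, integral_smul_measure, ENNReal.toReal_ofReal (by positivity),
    smul_eq_mul, inv_mul_eq_div] at h3
  exact h3.symm

theorem eventually_not_aestronglyMeasurable_mul {E : Type*} [NormedAddCommGroup E]
    [NormedSpace ℝ E] [FiniteDimensional ℝ E] [MeasurableSpace E] [BorelSpace E] (μ : Measure E)
    [μ.IsAddHaarMeasure] {k : ℕ} {q : E → ℝ} (hq : Measurable q)
    (hqc : ∀ᵐ x ∂μ, ContinuousAt q x) (hqne : ¬ q =ᵐ[μ] 0)
    {g : (Fin k → E) → ℝ} {R : ℝ} (hgR : ∀ y, g y ≠ 0 → ‖y‖ ≤ R)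
    (hg : ¬ AEStronglyMeasurable g (Measure.pi fun _ => μ)) :
    ∀ᶠ r : ℝ in nhdsWithin 0 (Set.Ioi 0), ¬ AEStronglyMeasurable
      (fun p : E × (Fin k → E) => q p.1 * (∏ i, q (p.1 + r • p.2 i)) * g p.2)
      (μ.prod (Measure.pi fun _ => μ)) := by
  obtain ⟨x₀, hx₀, hqx₀⟩ : ∃ x₀, q x₀ ≠ 0 ∧ ContinuousAt q x₀ := by
    by_contra! h
    exact hqne (hqc.mono fun x hx => by_contra fun h0 => h x h0 hx)
  obtain ⟨δ, hδ, hball⟩ := Metric.eventually_nhds_iff_ball.1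
    (hqx₀.eventually_ne hx₀)
  have hsmall : ∀ᶠ r : ℝ in nhdsWithin 0 (Set.Ioi 0), r * R < δ / 2 := by
    have : Tendsto (fun r : ℝ => r * R) (nhdsWithin 0 (Set.Ioi 0)) (nhds 0) :=
      tendsto_nhdsWithin_of_tendsto_nhds ((continuous_mul_const R).tendsto' 0 0 (by simp))
    exact this.eventually_lt_const (by positivity)
  filter_upwards [hsmall, self_mem_nhdsWithin] with r hr hr0 hm
  rw [Set.mem_Ioi] at hr0
  have hpos : μ (Metric.ball x₀ (δ / 2)) ≠ 0 :=
    (Metric.measure_ball_pos μ x₀ (by positivity)).ne'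
  obtain ⟨x, hx, hxm⟩ : ∃ x ∈ Metric.ball x₀ (δ / 2), AEStronglyMeasurable
      (fun y : Fin k → E => q x * (∏ i, q (x + r • y i)) * g y) (Measure.pi fun _ => μ) :=
    ((frequently_ae_mem_iff.2 hpos).and_eventually hm.prodMk_left).exists
  refine hg ?_
  have hw : Measurable fun y : Fin k → E => (q x * ∏ i, q (x + r • y i))⁻¹ := by fun_prop
  convert hw.aestronglyMeasurable.mul hxm using 1
  ext y
  by_cases hy : g y = 0
  · simp [hy]
  · rw [Pi.mul_apply, inv_mul_cancel_left₀]
    refine mul_ne_zero (hball x (Metric.ball_subset_ball (by linarith) hx))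
      (Finset.prod_ne_zero_iff.2 fun i _ => hball _ ?_)
    rw [Metric.mem_ball, dist_eq_norm] at hx ⊢
    calc ‖x + r • y i - x₀‖ = ‖(x - x₀) + r • y i‖ := by congr 1; abel
      _ ≤ ‖x - x₀‖ + r * ‖y i‖ := by
        grw [norm_add_le, norm_smul, Real.norm_of_nonneg hr0.le]
      _ ≤ ‖x - x₀‖ + r * R := by
        gcongr
        exact (norm_le_pi_norm y i).trans (hgR y hy)
      _ < δ := by linarith

theorem tendsto_integral_mul_prod_add_smul {E : Type*} [NormedAddCommGroup E]
    [NormedSpace ℝ E] [FiniteDimensional ℝ E] [MeasurableSpace E] [BorelSpace E] (μ : Measure E)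
    [μ.IsAddHaarMeasure] {k : ℕ} {q : E → ℝ} (hq0 : ∀ x, 0 ≤ q x)
    (hqi : Integrable q μ) (hq : Measurable q) {Q : ℝ} (hqQ : ∀ x, q x ≤ Q)
    (hqc : ∀ᵐ x ∂μ, ContinuousAt q x) (hqne : ¬ q =ᵐ[μ] 0)
    {g : (Fin k → E) → ℝ} {R C : ℝ} (hgR : ∀ y, g y ≠ 0 → ‖y‖ ≤ R) (hgC : ∀ y, ‖g y‖ ≤ C) :
    Tendsto (fun r : ℝ => ∫ p, q p.1 * (∏ i, q (p.1 + r • p.2 i)) * g p.2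
        ∂(μ.prod (Measure.pi fun _ : Fin k => μ)))
      (nhdsWithin 0 (Set.Ioi 0))
      (nhds ((∫ x, q x ^ (k + 1) ∂μ) * ∫ y, g y ∂(Measure.pi fun _ => μ))) := by
  by_cases hg : AEStronglyMeasurable g (Measure.pi fun _ => μ)
  · rw [← integral_prod_mul]
    have hgi : Integrable g (Measure.pi fun _ => μ) := by
      refine (integrableOn_iff_integrable_of_support_subset
        (s := Metric.closedBall 0 R) fun y hy => by simpa using hgR y hy).1 ?_
      exact Measure.integrableOn_of_bounded measure_closedBall_lt_top.ne hg (.of_forall hgC)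
    refine tendsto_integral_filter_of_dominated_convergence
      (fun p => (q p.1 * Q ^ k) * ‖g p.2‖) (.of_forall fun r => ?_) (.of_forall fun r => ?_)
      ((hqi.mul_const _).mul_prod hgi.norm) ?_
    · exact (Measurable.aestronglyMeasurable (by fun_prop)).mul hg.comp_snd
    · refine .of_forall fun p => ?_
      have hprod : ∏ i, q (p.1 + r • p.2 i) ≤ Q ^ k := by
        simpa using Finset.prod_le_prod (s := Finset.univ)
          (fun i _ => hq0 (p.1 + r • p.2 i)) fun i _ => hqQ _
      rw [norm_mul, Real.norm_of_nonneg
        (mul_nonneg (hq0 _) (Finset.prod_nonneg fun i _ => hq0 _))]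
      have := hq0 p.1
      gcongr
    · filter_upwards [Measure.quasiMeasurePreserving_fst.ae hqc] with p hp
      have hi (i : Fin k) : Tendsto (fun r : ℝ => q (p.1 + r • p.2 i))
          (nhdsWithin 0 (Set.Ioi 0)) (nhds (q p.1)) := by
        refine hp.tendsto.comp (tendsto_nhdsWithin_of_tendsto_nhds ?_)
        exact Continuous.tendsto' (by fun_prop) _ _ (by simp)
      have := ((tendsto_finsetProd Finset.univ fun i _ => hi i).const_mul (q p.1)).mul_const (g p.2)
      simpa [pow_succ'] using this
  · have h := eventually_not_aestronglyMeasurable_mul μ hq hqc hqne hgR hg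
    rw [integral_undef fun hi => hg hi.aestronglyMeasurable, mul_zero]
    exact tendsto_const_nhds.congr' (h.mono fun r hr =>
      (integral_undef fun hi => hr hi.aestronglyMeasurable).symm)

/-- Scaling lemma (case `ℓ = 1`).  Here `ξ r` is the functional `ξ_{k,r}` on
`(k+1)`-tuples of points of `ℝ^d` (so "k" of the paper is `k+1 ≥ 2`), assumed nonnegative,
translation/scale invariant, local with radius `r_max` and bounded.  For iid points with a
bounded a.e.-continuous density `q`,
`lim_{r→0⁺} r^{−d·k} E[ξ_r(X₀,…,X_k)] = ∫ q(x)^{k+1} dx · ∫_{(ℝ^d)^k} ξ₁(0,y) dy`. -/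
theorem scaling_limit_single (d k : ℕ) (hd : 0 < d) (hk : 1 ≤ k)
    (ξ : ℝ → (Fin (k + 1) → EuclideanSpace ℝ (Fin d)) → ℝ)
    (hnonneg : ∀ r S, 0 ≤ ξ r S)
    (hinv : ∀ (α : ℝ), 0 < α → ∀ (x : EuclideanSpace ℝ (Fin d)) (r : ℝ), 0 < r →
      ∀ S, ξ r (fun i => α • S i + x) = ξ (r / α) S)
    (rmax : ℝ) (hrmax : 0 < rmax)
    (hloc : ∀ S, (∃ i j, rmax < dist (S i) (S j)) → ξ 1 S = 0)
    (hbdd : ∃ C, ∀ S, ξ 1 S ≤ C)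
    (q : EuclideanSpace ℝ (Fin d) → ℝ)
    (hq_meas : Measurable q) (hq_nonneg : ∀ x, 0 ≤ q x) (hq_bdd : ∃ C, ∀ x, q x ≤ C)
    (hq_cont : ∀ᵐ x : EuclideanSpace ℝ (Fin d), ContinuousAt q x)
    (μq : Measure (EuclideanSpace ℝ (Fin d)))
    (hμq : μq = volume.withDensity fun x => ENNReal.ofReal (q x))
    (hμq_prob : IsProbabilityMeasure μq) :
    Filter.Tendsto (fun r : ℝ =>
        (∫ x : Fin (k + 1) → EuclideanSpace ℝ (Fin d), ξ r x ∂(Measure.pi fun _ => μq))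
          / r ^ (d * k))
      (nhdsWithin 0 (Set.Ioi 0))
      (nhds ((∫ x, q x ^ (k + 1)) *
        ∫ y : Fin k → EuclideanSpace ℝ (Fin d), ξ 1 (Fin.cons 0 y))) := by
  obtain ⟨C, hC⟩ := hbdd
  obtain ⟨Q, hQ⟩ := hq_bdd
  subst hμq
  have hlint : ∫⁻ x, ENNReal.ofReal (q x) = 1 := by
    rw [← setLIntegral_univ, ← withDensity_apply _ MeasurableSet.univ, hμq_prob.measure_univ]
  have hqi : Integrable q := by
    refine ⟨hq_meas.aestronglyMeasurable, ?_⟩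
    rw [hasFiniteIntegral_iff_ofReal (.of_forall hq_nonneg), hlint]
    exact ENNReal.one_lt_top
  have hqne : ¬ q =ᵐ[volume] 0 := fun h => by
    have h0 : ∫⁻ x, ENNReal.ofReal (q x) = 0 := by
      rw [lintegral_congr_ae (h.mono fun x hx => by rw [hx]; simp :
        _ =ᵐ[volume] fun _ => (0 : ENNReal)), lintegral_zero]
    simp [h0] at hlint
  have hsupp (y : Fin k → EuclideanSpace ℝ (Fin d)) (hy : ξ 1 (Fin.cons 0 y) ≠ 0) :
      ‖y‖ ≤ rmax := by
    refine (pi_norm_le_iff_of_nonneg hrmax.le).2 fun i => not_lt.1 fun hi => ?_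
    exact hy (hloc _ ⟨i.succ, 0, by simpa using hi⟩)
  refine (tendsto_integral_mul_prod_add_smul volume hq_nonneg hqi hq_meas hQ hq_cont hqne hsupp
    fun y => (Real.norm_of_nonneg (hnonneg 1 _)).trans_le (hC _)).congr' ?_
  filter_upwards [self_mem_nhdsWithin] with r hr
  rw [Set.mem_Ioi] at hr
  have h := integral_pi_withDensity_cons_add_smul volume (k := k) hq_meas hq_nonneg (ξ r) hr
  rw [finrank_euclideanSpace_fin] at h
  rw [h]
  congr 1 with p
  rw [← div_self hr.ne', ← hinv r hr p.1 r hr]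
  congr 2
  ext1 i
  refine Fin.cases ?_ (fun j => ?_) i
  · simp
  · simp [add_comm]
end

section
/- Under the hypotheses of the scaling lemma with ℓ functionals ξ_{k_j,r} (each translation/scale invariant, local with radius r_max, bounded) and an intersection pattern I = I_ℓ whose intersection graph is connected, if X is a tuple of |I| iid points with bounded a.e.-continuous density q and (T₁,...,T_ℓ) = Π_I(X), then lim_{r→0} r^{−d(|I|−1)} E[∏_{j=1}^ℓ ξ_{k_j,r}(T_j)] = ∫_{ℝ^d} q(x)^{|I|} dx · ∫_{(ℝ^d)^{|I|−1}} ∏_{j=1}^ℓ ξ_{k_j,1}(Π_I(0,y)_j) dy, and this limit is a finite nonnegative constant. -/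
open MeasureTheory Real Filter

noncomputable instance (d : ℕ) : DecidableEq (EuclideanSpace ℝ (Fin d)) := Classical.decEq _

theorem lintegral_pi_prod_eq_prod_lintegral {α : Type*} [MeasurableSpace α] (μ : Measure α)
    [SigmaFinite μ] {n : ℕ} (f : Fin n → α → ENNReal) (hf : ∀ i, Measurable (f i)) :
    ∫⁻ x, ∏ i, f i (x i) ∂(Measure.pi fun _ : Fin n => μ) = ∏ i, ∫⁻ a, f i a ∂μ := by
  induction n with
  | zero => simp
  | succ n ih =>
    have hmp := (measurePreserving_piFinSuccAbove (fun _ : Fin (n + 1) => μ) 0).symm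
    rw [← hmp.lintegral_comp_emb (MeasurableEquiv.measurableEmbedding _)]
    simp only [Fin.prod_univ_succ]
    have h := lintegral_prod_mul (μ := μ) (ν := Measure.pi fun _ : Fin n => μ)
      (f := f 0) (g := fun y => ∏ i : Fin n, f i.succ (y i)) (hf 0).aemeasurable
      (Finset.measurable_prod _ fun i _ =>
        (hf i.succ).comp (measurable_pi_apply i)).aemeasurable
    rw [ih _ fun i => hf i.succ] at h
    exact h

theorem pi_withDensity {α : Type*} [MeasurableSpace α] (μ : Measure α) [SigmaFinite μ]
    {n : ℕ} (f : α → ENNReal) (hf : Measurable f) [SigmaFinite (μ.withDensity f)] :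
    (Measure.pi fun _ : Fin n => μ.withDensity f) =
      (Measure.pi fun _ : Fin n => μ).withDensity fun x => ∏ i, f (x i) := by
  refine Measure.pi_eq fun s hs => ?_
  have h : ∀ x : Fin n → α, (Set.univ.pi s).indicator (fun x => ∏ i, f (x i)) x =
      ∏ i, (s i).indicator f (x i) := by
    intro x
    by_cases hx : x ∈ Set.univ.pi s
    · rw [Set.indicator_of_mem hx]
      exact Finset.prod_congr rfl fun i _ => (Set.indicator_of_mem (hx i trivial) f).symm
    · rw [Set.indicator_of_notMem hx]
      simp only [Set.mem_univ_pi, not_forall] at hx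
      obtain ⟨i, hi⟩ := hx
      exact (Finset.prod_eq_zero (Finset.mem_univ i) (Set.indicator_of_notMem hi f)).symm
  have hS : MeasurableSet (Set.univ.pi s) := MeasurableSet.univ_pi hs
  rw [withDensity_apply _ hS, ← lintegral_indicator hS]
  simp_rw [h]
  rw [lintegral_pi_prod_eq_prod_lintegral μ _ fun i => hf.indicator (hs i)]
  exact Finset.prod_congr rfl fun i _ => by
    rw [lintegral_indicator (hs i), withDensity_apply _ (hs i)]

section Haar

variable {E : Type*} [NormedAddCommGroup E] [NormedSpace ℝ E] [FiniteDimensional ℝ E]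
  [MeasurableSpace E] [BorelSpace E]

/-- The map `(a, y) ↦ (a, a + r • y)`, with `a` added to every coordinate of `r • y`. -/
noncomputable def shearScale (m : ℕ) (r : ℝ) (hr : r ≠ 0) :
    E × (Fin m → E) ≃ᵐ E × (Fin m → E) where
  toFun p := (p.1, fun i => p.1 + r • p.2 i)
  invFun p := (p.1, fun i => r⁻¹ • (p.2 i - p.1))
  left_inv p := by
    ext i <;> simp [hr]
  right_inv p := by
    ext i <;> simp [hr]
  measurable_toFun := by
    simp only [Equiv.coe_fn_mk]
    fun_prop
  measurable_invFun := by
    simp only [Equiv.coe_fn_symm_mk]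
    fun_prop

theorem integral_pi_succ_eq_shearScale (μ : Measure E) [μ.IsAddHaarMeasure] (m : ℕ) (r : ℝ)
    (hr : 0 < r) (G : (Fin (m + 1) → E) → ℝ) :
    ∫ x, G x ∂(Measure.pi fun _ : Fin (m + 1) => μ) =
      r ^ (Module.finrank ℝ E * m) * ∫ p : E × (Fin m → E),
        G (Fin.cons p.1 fun i => p.1 + r • p.2 i) ∂(μ.prod (Measure.pi fun _ : Fin m => μ)) := by
  have hmp := (measurePreserving_piFinSuccAbove (fun _ : Fin (m + 1) => μ) 0).symm
  rw [← hmp.integral_comp (MeasurableEquiv.measurableEmbedding _)]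
  set ν : Measure (Fin m → E) := Measure.pi fun _ : Fin m => μ
  set c : ENNReal := ENNReal.ofReal |(r ^ Module.finrank ℝ (Fin m → E))⁻¹|
  have hsk : MeasurePreserving (shearScale (E := E) m r hr.ne') (μ.prod ν) (μ.prod (c • ν)) := by
    refine MeasurePreserving.skew_product (f := id) (g := fun (a : E) (y : Fin m → E) i => a + r • y i)
      (MeasurePreserving.id μ) (by simp only [Function.uncurry_def]; fun_prop) ?_
    refine Eventually.of_forall fun a => ?_
    have h1 : (fun (y : Fin m → E) i => a + r • y i) =
        (fun y => (fun _ => a) + y) ∘ fun y => r • y := by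
      ext; simp
    rw [h1, ← Measure.map_map (by fun_prop) (by fun_prop), Measure.map_addHaar_smul ν hr.ne',
      Measure.map_smul, map_add_left_eq_self]
  have h := hsk.integral_comp (MeasurableEquiv.measurableEmbedding _)
    fun p => G ((MeasurableEquiv.piFinSuccAbove (fun _ : Fin (m + 1) => E) 0).symm p)
  rw [Measure.prod_smul_right, integral_smul_measure] at h
  have hfr : Module.finrank ℝ (Fin m → E) = Module.finrank ℝ E * m := by
    simp [Module.finrank_pi_fintype, mul_comm]
  have hc : c.toReal = (r ^ (Module.finrank ℝ E * m))⁻¹ := by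
    rw [ENNReal.toReal_ofReal (abs_nonneg _), hfr, abs_of_pos (by positivity)]
  rw [hc, smul_eq_mul, eq_inv_mul_iff_mul_eq₀ (by positivity)] at h
  have hcons : ∀ p : E × (Fin m → E),
      (MeasurableEquiv.piFinSuccAbove (fun _ : Fin (m + 1) => E) 0).symm p = Fin.cons p.1 p.2 :=
    fun p => Fin.insertNth_zero' p.1 p.2
  simp only [hcons] at h ⊢
  exact h.symm

theorem tendsto_integral_mul_density (μ : Measure E) [μ.IsAddHaarMeasure] {m : ℕ}
    (g : (Fin m → E) → ℝ) (C R : ℝ) (hgC : ∀ y, |g y| ≤ C) (hgR : ∀ y, g y ≠ 0 → ‖y‖ ≤ R)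
    (q : E → ℝ) (hq : Measurable q) (hq0 : ∀ x, 0 ≤ q x) (hqb : ∃ C, ∀ x, q x ≤ C)
    (hqc : ∀ᵐ x ∂μ, ContinuousAt q x) (hqi : Integrable q μ)
    (hqpos : ∃ x, ContinuousAt q x ∧ 0 < q x) :
    Tendsto (fun r : ℝ => ∫ p : E × (Fin m → E), g p.2 * (q p.1 * ∏ i, q (p.1 + r • p.2 i))
        ∂(μ.prod (Measure.pi fun _ : Fin m => μ)))
      (nhdsWithin 0 (Set.Ioi 0))
      (nhds ((∫ x, q x ^ (m + 1) ∂μ) * ∫ y, g y ∂(Measure.pi fun _ : Fin m => μ))) := by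
  set ν : Measure (Fin m → E) := Measure.pi fun _ : Fin m => μ
  obtain ⟨M, hM⟩ := hqb
  have hQ : ∀ r : ℝ, Measurable fun p : E × (Fin m → E) =>
      q p.1 * ∏ i, q (p.1 + r • p.2 i) := by
    intro r
    refine (hq.comp measurable_fst).mul (Finset.measurable_prod _ fun i _ => hq.comp ?_)
    fun_prop
  by_cases hg : AEStronglyMeasurable g ν
  · have hgi : Integrable g ν := by
      rw [← integrableOn_iff_integrable_of_support_subset (s := Metric.closedBall 0 R)
        fun y hy => by simpa using hgR y hy]
      exact Measure.integrableOn_of_bounded (M := C) (measure_closedBall_lt_top).ne hg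
        (Eventually.of_forall hgC)
    have hlim : (∫ x, q x ^ (m + 1) ∂μ) * ∫ y, g y ∂ν =
        ∫ p : E × (Fin m → E), g p.2 * q p.1 ^ (m + 1) ∂(μ.prod ν) := by
      rw [← integral_prod_mul]
      exact integral_congr_ae (Eventually.of_forall fun p => mul_comm _ _)
    rw [hlim]
    refine tendsto_integral_filter_of_dominated_convergence
      (fun p => M ^ m * (q p.1 * |g p.2|)) ?_ ?_ ?_ ?_
    · exact Eventually.of_forall fun r => hg.comp_snd.mul (hQ r).aestronglyMeasurable
    · refine Eventually.of_forall fun r => Eventually.of_forall fun p => ?_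
      have h1 : ∏ i, q (p.1 + r • p.2 i) ≤ M ^ m := by
        simpa using Finset.prod_le_prod (s := Finset.univ)
          (fun (i : Fin m) _ => hq0 (p.1 + r • p.2 i))
          fun i _ => hM (p.1 + r • p.2 i)
      have h2 : 0 ≤ ∏ i, q (p.1 + r • p.2 i) := Finset.prod_nonneg fun i _ => hq0 _
      rw [Real.norm_eq_abs, abs_mul, abs_of_nonneg (mul_nonneg (hq0 p.1) h2)]
      calc |g p.2| * (q p.1 * ∏ i, q (p.1 + r • p.2 i))
          = (∏ i, q (p.1 + r • p.2 i)) * (q p.1 * |g p.2|) := by ring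
        _ ≤ _ := mul_le_mul_of_nonneg_right h1 (mul_nonneg (hq0 _) (abs_nonneg _))
    · exact (hqi.mul_prod hgi.abs).const_mul _
    · have h := Measure.quasiMeasurePreserving_fst (μ := μ) (ν := ν) |>.ae hqc
      filter_upwards [h] with p hp
      rw [pow_succ']
      refine ((tendsto_const_nhds).mul ?_).const_mul _
      have h3 : ∀ i : Fin m, Tendsto (fun r : ℝ => q (p.1 + r • p.2 i))
          (nhdsWithin 0 (Set.Ioi 0)) (nhds (q p.1)) := by
        intro i
        refine hp.tendsto.comp (Tendsto.mono_left ?_ nhdsWithin_le_nhds)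
        have : Continuous fun r : ℝ => p.1 + r • p.2 i := by fun_prop
        simpa using this.tendsto 0
      simpa using tendsto_finsetProd Finset.univ fun i _ => h3 i
  · rw [integral_undef (fun h => hg h.aestronglyMeasurable), mul_zero]
    refine tendsto_const_nhds.congr' ?_
    obtain ⟨x₀, hx₀, hx₀pos⟩ := hqpos
    obtain ⟨ε, hε, hball⟩ := Metric.eventually_nhds_iff.1 (hx₀.eventually_const_lt hx₀pos)
    have hr1 : ∀ᶠ r : ℝ in nhdsWithin 0 (Set.Ioi 0), r * R < ε / 2 := by
      refine Tendsto.eventually_lt_const (half_pos hε) (Tendsto.mono_left ?_ nhdsWithin_le_nhds)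
      have : Continuous fun r : ℝ => r * R := by fun_prop
      simpa using this.tendsto 0
    filter_upwards [hr1, self_mem_nhdsWithin] with r hr (hr0 : 0 < r)
    refine (integral_undef fun h => hg ?_).symm
    have hsec := h.aestronglyMeasurable.prodMk_left
    have hne : ∃ a ∈ Metric.ball x₀ (ε / 2), AEStronglyMeasurable
        (fun y => g y * (q a * ∏ i, q (a + r • y i))) ν := by
      by_contra! hcon
      have h0 : μ (Metric.ball x₀ (ε / 2)) = 0 :=
        measure_mono_null (fun a ha => hcon a ha) hsec
      exact (Metric.measure_ball_pos μ x₀ (half_pos hε)).ne' h0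
    obtain ⟨a, ha, hm⟩ := hne
    have hQa : Measurable fun y : Fin m → E => q a * ∏ i, q (a + r • y i) :=
      (hQ r).comp measurable_prodMk_left
    refine (hm.aemeasurable.div hQa.aemeasurable).aestronglyMeasurable.congr
      (Eventually.of_forall fun y => ?_)
    by_cases hy : g y = 0
    · simp [hy]
    · have hyR := hgR y hy
      have hpos : 0 < q a * ∏ i, q (a + r • y i) := by
        refine mul_pos (hball ?_) (Finset.prod_pos fun i _ => hball ?_)
        · exact (Metric.mem_ball.1 ha).trans (half_lt_self hε)
        · have h1 : dist (a + r • y i) a < ε / 2 := by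
            rw [dist_eq_norm, add_sub_cancel_left, norm_smul, Real.norm_of_nonneg hr0.le]
            exact (mul_le_mul_of_nonneg_left ((norm_le_pi_norm y i).trans hyR) hr0.le).trans_lt hr
          have h2 := Metric.mem_ball.1 ha
          linarith [dist_triangle (a + r • y i) a x₀]
      exact mul_div_cancel_right₀ _ hpos.ne'

end Haar

theorem exists_dist_le_of_connected {ι κ P : Type*} [Fintype κ] [DecidableEq ι]
    [PseudoMetricSpace P] (A : κ → Finset ι) (hcover : ∀ i, ∃ j, i ∈ A j)
    (hconn : (SimpleGraph.fromRel fun i j : κ => (A i ∩ A j).Nonempty).Connected)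
    (ρ : ℝ) (i₀ : ι) :
    ∃ R : ℝ, ∀ x : ι → P, (∀ j, ∀ i ∈ A j, ∀ i' ∈ A j, dist (x i) (x i') ≤ ρ) →
      ∀ i, dist (x i) (x i₀) ≤ R := by
  obtain ⟨j₀, hj₀⟩ := hcover i₀
  have key : ∀ j, ∃ R : ℝ, ∀ x : ι → P,
      (∀ j, ∀ i ∈ A j, ∀ i' ∈ A j, dist (x i) (x i') ≤ ρ) →
      ∀ i ∈ A j, dist (x i) (x i₀) ≤ R := by
    intro j
    have hreach := hconn.preconnected j₀ j
    rw [SimpleGraph.reachable_iff_reflTransGen] at hreach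
    induction hreach with
    | refl => exact ⟨ρ, fun x hx i hi => hx _ i hi i₀ hj₀⟩
    | @tail b c _ hadj ih =>
      obtain ⟨R, hR⟩ := ih
      refine ⟨ρ + R, fun x hx i hi => ?_⟩
      have hne : (A b ∩ A c).Nonempty := by
        rcases (SimpleGraph.fromRel_adj _ _ _).1 hadj with ⟨_, h | h⟩
        · exact h
        · rwa [Finset.inter_comm]
      obtain ⟨i', hi'⟩ := hne
      rw [Finset.mem_inter] at hi'
      exact (dist_triangle _ (x i') _).trans
        (add_le_add (hx c i hi i' hi'.2) (hR x hx i' hi'.1))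
  choose R hR using key
  refine ⟨∑ j, |R j|, fun x hx i => ?_⟩
  obtain ⟨j, hj⟩ := hcover i
  exact ((hR j x hx i hj).trans (le_abs_self _)).trans
    (Finset.single_le_sum (f := fun j => |R j|) (fun j _ => abs_nonneg _) (Finset.mem_univ j))

/-- Scaling lemma, general `ℓ`, connected intersection pattern.  An intersection
pattern with `|I| = m+1` points is encoded by index sets `A j ⊆ Fin (m+1)` with `|A j| = k j`,
covering all indices; the pattern splitting is `T_j = x(A j)`.  Connectivity of the
intersection graph (`i ~ j` iff `A i ∩ A j ≠ ∅`) is assumed.  Each `ξ j` is nonnegative,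
vanishes off cardinality `k j`, is translation/scale invariant, local and bounded.  Then
`lim_{r→0⁺} r^{−d·m} E[∏_j ξ_{k_j,r}(T_j)] = ∫ q^{m+1} · ∫_{(ℝ^d)^m} ∏_j ξ_{k_j,1}(Π_I(0,y)_j) dy`,
a finite nonnegative constant. -/
theorem scaling_limit_general (d ℓ m : ℕ) (hd : 0 < d) (hℓ : 1 ≤ ℓ)
    (k : Fin ℓ → ℕ) (hk : ∀ j, 2 ≤ k j)
    (A : Fin ℓ → Finset (Fin (m + 1)))
    (hcard : ∀ j, (A j).card = k j)
    (hcover : ∀ i : Fin (m + 1), ∃ j, i ∈ A j)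
    (hconn : (SimpleGraph.fromRel fun i j : Fin ℓ => (A i ∩ A j).Nonempty).Connected)
    (ξ : Fin ℓ → ℝ → Finset (EuclideanSpace ℝ (Fin d)) → ℝ)
    (hnonneg : ∀ j r S, 0 ≤ ξ j r S)
    (hvanish : ∀ j r S, S.card ≠ k j → ξ j r S = 0)
    (hinv : ∀ j (α : ℝ), 0 < α → ∀ (x : EuclideanSpace ℝ (Fin d)) (r : ℝ), 0 < r → ∀ S,
      ξ j r (S.image fun p => α • p + x) = ξ j (r / α) S)
    (rmax : ℝ) (hrmax : 0 < rmax)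
    (hloc : ∀ j S, (∃ p ∈ S, ∃ p' ∈ S, rmax < dist p p') → ξ j 1 S = 0)
    (hbdd : ∃ C, ∀ j S, ξ j 1 S ≤ C)
    (q : EuclideanSpace ℝ (Fin d) → ℝ)
    (hq_meas : Measurable q) (hq_nonneg : ∀ x, 0 ≤ q x) (hq_bdd : ∃ C, ∀ x, q x ≤ C)
    (hq_cont : ∀ᵐ x : EuclideanSpace ℝ (Fin d), ContinuousAt q x)
    (μq : Measure (EuclideanSpace ℝ (Fin d)))
    (hμq : μq = volume.withDensity fun x => ENNReal.ofReal (q x))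
    (hμq_prob : IsProbabilityMeasure μq) :
    Filter.Tendsto (fun r : ℝ =>
        (∫ x : Fin (m + 1) → EuclideanSpace ℝ (Fin d),
            ∏ j, ξ j r ((A j).image x) ∂(Measure.pi fun _ => μq)) / r ^ (d * m))
      (nhdsWithin 0 (Set.Ioi 0))
      (nhds ((∫ x, q x ^ (m + 1)) *
        ∫ y : Fin m → EuclideanSpace ℝ (Fin d), ∏ j, ξ j 1 ((A j).image (Fin.cons 0 y)))) ∧
    0 ≤ (∫ x, q x ^ (m + 1)) *
        ∫ y : Fin m → EuclideanSpace ℝ (Fin d), ∏ j, ξ j 1 ((A j).image (Fin.cons 0 y)) := by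
  set g : (Fin m → EuclideanSpace ℝ (Fin d)) → ℝ :=
    fun y => ∏ j, ξ j 1 ((A j).image (Fin.cons 0 y)) with hg
  have hg0 : ∀ y, 0 ≤ g y := fun y => Finset.prod_nonneg fun j _ => hnonneg j _ _
  refine ⟨?_, mul_nonneg (integral_nonneg fun x => pow_nonneg (hq_nonneg x) _)
    (integral_nonneg hg0)⟩
  obtain ⟨C, hC⟩ := hbdd
  have hgC : ∀ y, |g y| ≤ C ^ ℓ := by
    intro y
    rw [abs_of_nonneg (hg0 y)]
    simpa using Finset.prod_le_prod (s := Finset.univ)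
      (fun (j : Fin ℓ) _ => hnonneg j 1 ((A j).image (Fin.cons 0 y))) fun j _ => hC j _
  obtain ⟨R, hR⟩ := exists_dist_le_of_connected (P := EuclideanSpace ℝ (Fin d))
    A hcover hconn rmax 0
  have hgR : ∀ y, g y ≠ 0 → ‖y‖ ≤ R := by
    intro y hy
    have hdist := hR (Fin.cons 0 y) fun j i hi i' hi' => by
      by_contra! hlt
      exact hy (Finset.prod_eq_zero (Finset.mem_univ j) (hloc j _
        ⟨_, Finset.mem_image_of_mem _ hi, _, Finset.mem_image_of_mem _ hi', hlt⟩))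
    refine (pi_norm_le_iff_of_nonneg (by simpa using hdist 0)).2 fun i => ?_
    simpa using hdist i.succ
  have hscale : ∀ r : ℝ, 0 < r → ∀ (a : EuclideanSpace ℝ (Fin d))
      (y : Fin m → EuclideanSpace ℝ (Fin d)),
      ∏ j, ξ j r ((A j).image (Fin.cons a fun i => a + r • y i)) = g y := by
    intro r hr a y
    refine Finset.prod_congr rfl fun j _ => ?_
    have h := hinv j r hr a r hr ((A j).image (Fin.cons 0 y))
    rw [div_self hr.ne', Finset.image_image] at h
    rw [← h]
    congr 2
    funext i
    refine Fin.cases ?_ (fun i => ?_) i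
    · simp
    · simp [add_comm]
  have hlint : ∫⁻ x, ENNReal.ofReal (q x) = 1 := by
    have h := hμq_prob.measure_univ
    rwa [hμq, withDensity_apply _ MeasurableSet.univ, Measure.restrict_univ] at h
  have hqi : Integrable q := by
    refine ⟨hq_meas.aestronglyMeasurable, ?_⟩
    rw [hasFiniteIntegral_iff_ofReal (Eventually.of_forall hq_nonneg), hlint]
    exact ENNReal.one_lt_top
  have hqpos : ∃ x, ContinuousAt q x ∧ 0 < q x := by
    by_contra! hcon
    have h0 : ∫⁻ x, ENNReal.ofReal (q x) = 0 := by
      rw [lintegral_eq_zero_iff hq_meas.ennreal_ofReal]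
      filter_upwards [hq_cont] with x hx
      exact ENNReal.ofReal_of_nonpos (hcon x hx)
    rw [h0] at hlint
    exact zero_ne_one hlint
  have hlim := tendsto_integral_mul_density volume g _ R hgC hgR q hq_meas hq_nonneg hq_bdd
    hq_cont hqi hqpos
  refine hlim.congr' ?_
  filter_upwards [self_mem_nhdsWithin] with r (hr : 0 < r)
  subst hμq
  have hprod : Measurable fun x : Fin (m + 1) → EuclideanSpace ℝ (Fin d) =>
      ∏ i, ENNReal.ofReal (q (x i)) :=
    Finset.measurable_prod _ fun i _ => hq_meas.ennreal_ofReal.comp (measurable_pi_apply i)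
  rw [pi_withDensity volume _ hq_meas.ennreal_ofReal,
    integral_withDensity_eq_integral_toReal_smul hprod
      (Eventually.of_forall fun x => ENNReal.prod_lt_top fun i _ => ENNReal.ofReal_lt_top),
    integral_pi_succ_eq_shearScale volume m r hr, finrank_euclideanSpace_fin,
    mul_div_cancel_left₀ _ (by positivity)]
  refine integral_congr_ae (Eventually.of_forall fun p => ?_)
  simp only [hscale r hr, ENNReal.toReal_prod, ENNReal.toReal_mul, ENNReal.toReal_ofReal (hq_nonneg _),
    Fin.prod_univ_succ, Fin.cons_zero, Fin.cons_succ, smul_eq_mul]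
  ring
end
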